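/- arXiv:2305.16327 — 2 statements merged into one kernel-verified Lean document; each statement's English description precedes it below -/
import Mathlib

section
/- For all X, Y ∈ 𝔤 one has ∇̃_{X^c}Y^c = (∇¹_X Y)^c. -/
/-- `g` is an inner product (symmetric positive-definite bilinear form) on a real vector space. -/
structure IsInnerProd {L : Type*} [AddCommGroup L] [Module ℝ L] (g : L → L → ℝ) : Prop where
  addLeft : ∀ x y z : L, g (x + y) z = g x z + g y z
  smulLeft : ∀ (a : ℝ) (x y : L), g (a • x) y = a * g x y
  symm : ∀ x y : L, g x y = g y x
  posDef : ∀ x : L, x ≠ 0 → 0 < g x x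

/-- The bracket of the tangent Lie algebra `T𝔤 = 𝔤 × 𝔤`:
`[(X₁,Y₁),(X₂,Y₂)] = ([X₁,X₂], [X₁,Y₂] + [Y₁,X₂])`.
The complete lift of `X` is `(X, 0)` and the vertical lift is `(0, X)`. -/
def tbr {L : Type*} [LieRing L] (A B : L × L) : L × L :=
  (⁅A.1, B.1⁆, ⁅A.1, B.2⁆ + ⁅A.2, B.1⁆)

/-- The lifted inner product `g̃` on `T𝔤 = 𝔤 × 𝔤` determined by
`g̃(X^c,Y^c) = ⟨X,Y⟩₁`, `g̃(X^v,Y^v) = ⟨X,Y⟩₂`, `g̃(X^c,Y^v) = 0`. -/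
def tg {L : Type*} (g1 g2 : L → L → ℝ) (A B : L × L) : ℝ :=
  g1 A.1 B.1 + g2 A.2 B.2

/-- `nab` is the Levi-Civita connection of the metric `g` with respect to the bracket `br`,
i.e. it satisfies the Koszul formula
`2⟨∇_X Y, Z⟩ = ⟨[X,Y],Z⟩ − ⟨[Y,Z],X⟩ + ⟨[Z,X],Y⟩`. -/
def IsLC {V : Type*} [AddCommGroup V] [Module ℝ V] (br : V → V → V)
    (g : V → V → ℝ) (nab : V → V → V) : Prop :=
  ∀ X Y Z : V, 2 * g (nab X Y) Z = g (br X Y) Z - g (br Y Z) X + g (br Z X) Y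

/-- The curvature tensor `R(X,Y)Z = ∇_X ∇_Y Z − ∇_Y ∇_X Z − ∇_{[X,Y]} Z`. -/
def curvOf {V : Type*} [AddCommGroup V] (br nab : V → V → V) (X Y Z : V) : V :=
  nab X (nab Y Z) - nab Y (nab X Z) - nab (br X Y) Z

namespace IsInnerProd

variable {L : Type*} [AddCommGroup L] [Module ℝ L] {g : L → L → ℝ}

lemma zero_left (hg : IsInnerProd g) (x : L) : g 0 x = 0 := by
  have h := hg.addLeft 0 0 x
  rw [add_zero] at h
  linarith

lemma zero_right (hg : IsInnerProd g) (x : L) : g x 0 = 0 := by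
  rw [hg.symm, hg.zero_left]

lemma eq_zero_of_self (hg : IsInnerProd g) {x : L} (h : g x x = 0) : x = 0 := by
  by_contra hx
  exact (hg.posDef x hx).ne' h

lemma ext_left (hg : IsInnerProd g) {x y : L} (h : ∀ z, g x z = g y z) : x = y := by
  refine sub_eq_zero.mp (hg.eq_zero_of_self ?_)
  have hadd := hg.addLeft (x - y) y (x - y)
  rw [sub_add_cancel, h] at hadd
  linarith

end IsInnerProd

theorem statement2 {L : Type*} [LieRing L] [Module ℝ L] [LieAlgebra ℝ L]
    [FiniteDimensional ℝ L]
    (g1 g2 : L → L → ℝ) (hg1 : IsInnerProd g1) (hg2 : IsInnerProd g2)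
    (nabla1 nabla2 : L → L → L)
    (hn1 : IsLC (fun X Y : L => ⁅X, Y⁆) g1 nabla1)
    (hn2 : IsLC (fun X Y : L => ⁅X, Y⁆) g2 nabla2)
    (tnabla : L × L → L × L → L × L)
    (htn : IsLC tbr (tg g1 g2) tnabla) :
    ∀ X Y : L, tnabla (X, 0) (Y, 0) = (nabla1 X Y, (0 : L)) := by
  intro X Y
  refine Prod.ext (hg1.ext_left fun Z => ?_) (hg2.eq_zero_of_self ?_)
  · have h := htn (X, 0) (Y, 0) (Z, 0)
    have h1 := hn1 X Y Z
    simp only [tg, tbr, lie_zero, zero_lie, add_zero, hg2.zero_right] at h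
    linarith
  · have h := htn (X, 0) (Y, 0) (0, (tnabla (X, 0) (Y, 0)).2)
    simp only [tg, tbr, lie_zero, zero_lie, add_zero, hg1.zero_left, hg1.zero_right,
      hg2.zero_left, hg2.zero_right] at h
    linarith
end

section
/- Let X ∈ 𝔤. (1) If X is a geodesic vector field with respect to ∇¹ (i.e. ∇¹_X X = 0), then X^c is a geodesic vector field with respect to ∇̃ (i.e. ∇̃_{X^c} X^c = 0). (2) If X is a geodesic vector field with respect to ∇² (i.e. ∇²_X X = 0), then X^v is a geodesic vector field with respect to ∇̃ (i.e. ∇̃_{X^v} X^v = 0). -/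
section InnerProd

variable {L : Type*} [AddCommGroup L] [Module ℝ L] {g : L → L → ℝ}

theorem IsInnerProd.zero_left_s7 (hg : IsInnerProd g) (y : L) : g 0 y = 0 := by
  have h := hg.addLeft 0 0 y
  rw [add_zero] at h
  linarith

theorem IsInnerProd.zero_right_s7 (hg : IsInnerProd g) (x : L) : g x 0 = 0 := by
  rw [hg.symm, hg.zero_left_s7]

theorem IsInnerProd.nonneg (hg : IsInnerProd g) (x : L) : 0 ≤ g x x := by
  by_cases hx : x = 0
  · rw [hx, hg.zero_left_s7]
  · exact (hg.posDef x hx).le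

theorem IsInnerProd.eq_zero_of_self_le (hg : IsInnerProd g) {x : L} (h : g x x ≤ 0) :
    x = 0 := by
  by_contra hx
  exact absurd (hg.posDef x hx) h.not_gt

/-- The lifted form `g̃` is positive definite. -/
theorem eq_zero_of_tg_self_eq_zero {g' : L → L → ℝ} (hg : IsInnerProd g)
    (hg' : IsInnerProd g') {A : L × L} (h : tg g g' A A = 0) : A = 0 := by
  have h₁ := hg.nonneg A.1
  have h₂ := hg'.nonneg A.2
  unfold tg at h
  exact Prod.ext (hg.eq_zero_of_self_le (by linarith)) (hg'.eq_zero_of_self_le (by linarith))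

end InnerProd

theorem statement7 {L : Type*} [LieRing L] [Module ℝ L] [LieAlgebra ℝ L]
    [FiniteDimensional ℝ L]
    (g1 g2 : L → L → ℝ) (hg1 : IsInnerProd g1) (hg2 : IsInnerProd g2)
    (nabla1 nabla2 : L → L → L)
    (hn1 : IsLC (fun X Y : L => ⁅X, Y⁆) g1 nabla1)
    (hn2 : IsLC (fun X Y : L => ⁅X, Y⁆) g2 nabla2)
    (tnabla : L × L → L × L → L × L)
    (htn : IsLC tbr (tg g1 g2) tnabla) :
    ∀ X : L,
      (nabla1 X X = 0 → tnabla (X, 0) (X, 0) = 0) ∧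
      (nabla2 X X = 0 → tnabla (0, X) (0, X) = 0) := by
  intro X
  constructor
  · intro hX
    apply eq_zero_of_tg_self_eq_zero hg1 hg2
    have h := htn (X, 0) (X, 0) (tnabla (X, 0) (X, 0))
    have h' := hn1 X X (tnabla (X, 0) (X, 0)).1
    simp only [hX, lie_self, hg1.zero_left_s7] at h'
    simp only [tbr, tg, lie_self, lie_zero, zero_lie, add_zero, hg1.zero_left_s7, hg2.zero_left_s7,
      hg2.zero_right_s7] at h
    simp only [tg]
    linarith
  · intro hX
    apply eq_zero_of_tg_self_eq_zero hg1 hg2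
    have h := htn (0, X) (0, X) (tnabla (0, X) (0, X))
    have h' := hn2 X X (tnabla (0, X) (0, X)).1
    simp only [hX, lie_self, hg2.zero_left_s7] at h'
    simp only [tbr, tg, lie_zero, zero_lie, add_zero, zero_add, hg1.zero_left_s7, hg2.zero_left_s7] at h
    simp only [tg]
    linarith
end
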